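/- There exists a nonempty compact set Y ⊆ ∂𝔻̄² with (0,0) ∈ Ŷ such that the set of those elements f of the Banach algebra P(Y) whose spectrum has empty interior in ℂ is dense in P(Y). -/

import Mathlib

open BoundedContinuousFunction Set

noncomputable def pev (q : MvPolynomial (Fin 2) ℂ) (z : ℂ × ℂ) : ℂ :=
  MvPolynomial.eval ![z.1, z.2] q

def bidisk : Set (ℂ × ℂ) := {z : ℂ × ℂ | ‖z.1‖ ≤ 1 ∧ ‖z.2‖ ≤ 1}

def polyHull (Y : Set (ℂ × ℂ)) : Set (ℂ × ℂ) :=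
  {z : ℂ × ℂ | ∀ (q : MvPolynomial (Fin 2) ℂ) (M : ℝ),
    (∀ y ∈ Y, ‖pev q y‖ ≤ M) → ‖pev q z‖ ≤ M}

/-- The subalgebra of `Y →ᵇ ℂ` consisting of restrictions to `Y` of polynomial
functions in the two complex coordinates. -/
noncomputable def polySub (Y : Set (ℂ × ℂ)) : Subalgebra ℂ (Y →ᵇ ℂ) where
  carrier := {f : Y →ᵇ ℂ | ∃ q : MvPolynomial (Fin 2) ℂ, ∀ y : Y, f y = pev q ↑y}
  mul_mem' := by
    rintro f g ⟨q, hq⟩ ⟨r, hr⟩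
    exact ⟨q * r, fun y => by simp [pev, hq y, hr y]⟩
  one_mem' := ⟨1, fun y => by simp [pev]⟩
  add_mem' := by
    rintro f g ⟨q, hq⟩ ⟨r, hr⟩
    exact ⟨q + r, fun y => by simp [pev, hq y, hr y]⟩
  zero_mem' := ⟨0, fun y => by simp [pev]⟩
  algebraMap_mem' := fun c => ⟨MvPolynomial.C c, fun y => by simp [pev]⟩

/-- `P(Y)`: the uniform closure of the polynomial restrictions, as a Banach algebra
(a closed subalgebra of the bounded continuous functions on `Y`). -/
noncomputable def PY (Y : Set (ℂ × ℂ)) : Subalgebra ℂ (Y →ᵇ ℂ) :=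
  (polySub Y).topologicalClosure

section PolynomialEvaluation

@[simp] theorem pev_add (p q : MvPolynomial (Fin 2) ℂ) (z : ℂ × ℂ) :
    pev (p + q) z = pev p z + pev q z := by simp [pev]

@[simp] theorem pev_sub (p q : MvPolynomial (Fin 2) ℂ) (z : ℂ × ℂ) :
    pev (p - q) z = pev p z - pev q z := by simp [pev]

@[simp] theorem pev_mul (p q : MvPolynomial (Fin 2) ℂ) (z : ℂ × ℂ) :
    pev (p * q) z = pev p z * pev q z := by simp [pev]

@[simp] theorem pev_pow (p : MvPolynomial (Fin 2) ℂ) (n : ℕ) (z : ℂ × ℂ) :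
    pev (p ^ n) z = pev p z ^ n := by simp [pev]

@[simp] theorem pev_C (c : ℂ) (z : ℂ × ℂ) : pev (MvPolynomial.C c) z = c := by simp [pev]

@[simp] theorem pev_one (z : ℂ × ℂ) : pev 1 z = 1 := by simp [pev]

theorem differentiable_pev (q : MvPolynomial (Fin 2) ℂ) : Differentiable ℂ (pev q) := by
  induction q using MvPolynomial.induction_on with
  | C a => simpa only [funext (pev_C a)] using differentiable_const a
  | add p q hp hq => exact (funext (pev_add p q)) ▸ hp.add hq
  | mul_X p i hp =>
    have hX : Differentiable ℂ (pev (MvPolynomial.X i)) := by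
      fin_cases i
      · exact (funext fun z => by simp [pev] : Prod.fst = pev (MvPolynomial.X 0)) ▸
          differentiable_fst
      · exact (funext fun z => by simp [pev] : Prod.snd = pev (MvPolynomial.X 1)) ▸
          differentiable_snd
    exact (funext (pev_mul p _)) ▸ hp.mul hX

theorem continuous_pev (q : MvPolynomial (Fin 2) ℂ) : Continuous (pev q) :=
  (differentiable_pev q).continuous

end PolynomialEvaluation

section Bidisk

theorem bidisk_eq_closedBall : bidisk = Metric.closedBall 0 1 := by
  ext z
  simp [bidisk, Prod.norm_def]

theorem isCompact_bidisk : IsCompact bidisk :=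
  bidisk_eq_closedBall ▸ isCompact_closedBall 0 1

theorem frontier_bidisk_subset : frontier bidisk ⊆ bidisk :=
  isCompact_bidisk.isClosed.frontier_subset

theorem isCompact_frontier_bidisk : IsCompact (frontier bidisk) :=
  isCompact_bidisk.of_isClosed_subset isClosed_frontier frontier_bidisk_subset

theorem zero_mem_bidisk : (0 : ℂ × ℂ) ∈ bidisk := by simp [bidisk]

theorem exists_norm_pev_le (q : MvPolynomial (Fin 2) ℂ) :
    ∃ B : ℝ, ∀ z ∈ bidisk, ‖pev q z‖ ≤ B :=
  isCompact_bidisk.exists_bound_of_continuousOn (continuous_pev q).continuousOn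

end Bidisk

section MaximumPrinciple

theorem Complex.norm_add_sq_eq (a b : ℂ) :
    ‖a + b‖ ^ 2 = ‖a‖ ^ 2 + 2 * (starRingEnd ℂ a * b).re + ‖b‖ ^ 2 := by
  simp only [← Complex.normSq_eq_norm_sq, Complex.normSq_apply, Complex.add_re, Complex.add_im,
    Complex.mul_re, Complex.conj_re, Complex.conj_im]
  ring

/-- A continuous linear functional on `ℂ²` has a nontrivial kernel. -/
theorem ContinuousLinearMap.exists_ne_zero_apply_eq_zero (A : ℂ × ℂ →L[ℂ] ℂ) :
    ∃ v : ℂ × ℂ, v ≠ 0 ∧ A v = 0 := by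
  by_cases h : A (1, 0) = 0
  · exact ⟨(1, 0), by simp, h⟩
  · refine ⟨(A (0, 1), -A (1, 0)), by simp [h], ?_⟩
    have key : ((A (0, 1), -A (1, 0)) : ℂ × ℂ)
        = A (0, 1) • ((1, 0) : ℂ × ℂ) - A (1, 0) • ((0, 1) : ℂ × ℂ) := by simp
    rw [key, map_sub, map_smul, map_smul]
    simp [mul_comm]

/-- The real part of a holomorphic function cannot be bounded above near a point by a
function with a strict local maximum there. -/
theorem Complex.not_eventually_re_le_neg_sq {H : ℂ → ℂ} (hH : Differentiable ℂ H) (h0 : H 0 = 0)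
    {c : ℝ} (hc : 0 < c) : ¬ ∀ᶠ ζ in nhds (0 : ℂ), (H ζ).re ≤ -(c * ‖ζ‖ ^ 2) := by
  intro h
  have hmax : IsLocalMax (norm ∘ fun ζ => Complex.exp (H ζ)) 0 := by
    filter_upwards [h] with ζ hζ
    simp only [Function.comp, Complex.norm_exp, h0, Complex.zero_re]
    exact Real.exp_le_exp.2 (hζ.trans (by simp; positivity))
  have hconst := Complex.eventually_eq_of_isLocalMax_norm
    (Filter.Eventually.of_forall fun ζ => (hH.cexp) ζ) hmax
  have hev := (h.and hconst).filter_mono (nhdsWithin_le_nhds (s := {0}ᶜ))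
  obtain ⟨ζ, ⟨h1, h2⟩, h3⟩ := (hev.and self_mem_nhdsWithin).exists
  have h4 : (H ζ).re = 0 := by
    have := congrArg norm h2
    simpa [Complex.norm_exp, h0] using this
  have h5 : 0 < ‖ζ‖ := norm_pos_iff.2 h3
  have : 0 < c * ‖ζ‖ ^ 2 := by positivity
  linarith

/-- Along a direction in the kernel of `dg` the function below is strictly subharmonic to
second order, so it has no local maximum. -/
theorem not_isLocalMax_norm_sq_add_sub {p g : ℂ × ℂ → ℂ} (hp : Differentiable ℂ p)
    (hg : Differentiable ℂ g) {ε K : ℝ} (hε : 0 < ε) (hK : 0 ≤ K) (x : ℂ × ℂ) :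
    ¬ IsLocalMax
      (fun z => ‖p z‖ ^ 2 + ε * (‖z.1‖ ^ 2 + ‖z.2‖ ^ 2) - K * ‖g z‖ ^ 2) x := by
  intro hmax
  obtain ⟨v, hv, hAv⟩ := (fderiv ℂ g x).exists_ne_zero_apply_eq_zero
  set l : ℂ → ℂ × ℂ := fun ζ => x + ζ • v with hl
  have hld : Differentiable ℂ l := by fun_prop
  have hl0 : l 0 = x := by simp [hl]
  have hpl : Differentiable ℂ fun ζ => p (l ζ) := hp.comp hld
  have hgl : Differentiable ℂ fun ζ => g (l ζ) := hg.comp hld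
  have hderiv : HasDerivAt (fun ζ => g (l ζ)) 0 0 := by
    have h1 : HasDerivAt l v 0 := by
      have h := ((hasDerivAt_id (0 : ℂ)).smul_const v).const_add x
      rwa [one_smul] at h
    have h2 : HasFDerivAt g (fderiv ℂ g x) (l 0) := hl0 ▸ (hg x).hasFDerivAt
    exact hAv ▸ h2.comp_hasDerivAt (0 : ℂ) h1
  set V : ℝ := ‖v.1‖ ^ 2 + ‖v.2‖ ^ 2 with hVdef
  have hV : 0 < V := by
    rcases not_and_or.1 (fun h : v.1 = 0 ∧ v.2 = 0 => hv (Prod.ext h.1 h.2)) with h | h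
    · have := norm_pos_iff.2 h; positivity
    · have := norm_pos_iff.2 h; positivity
  obtain ⟨δ, hδ, hδK⟩ : ∃ δ : ℝ, 0 < δ ∧ K * δ ^ 2 ≤ ε * V / 2 := by
    refine ⟨Real.sqrt (ε * V / 2 / (K + 1)), by positivity, ?_⟩
    rw [Real.sq_sqrt (by positivity), mul_div_assoc', div_le_iff₀ (by positivity)]
    nlinarith [mul_pos hε hV]
  have hsmall : ∀ᶠ ζ in nhds (0 : ℂ), ‖g (l ζ) - g x‖ ≤ δ * ‖ζ‖ := by
    have := (hasDerivAt_iff_isLittleO.1 hderiv).def hδ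
    simpa [hl0] using this
  have hloc : ∀ᶠ ζ in nhds (0 : ℂ), _ :=
    (hld.continuous.tendsto' 0 x hl0).eventually hmax
  set conj := starRingEnd ℂ
  refine Complex.not_eventually_re_le_neg_sq
    (H := fun ζ => 2 * conj (p x) * (p (l ζ) - p x)
      + 2 * ε * (conj x.1 * (ζ * v.1) + conj x.2 * (ζ * v.2))
      - 2 * K * conj (g x) * (g (l ζ) - g x))
    (by fun_prop) (by simp [hl0]) (c := ε * V / 2) (by positivity) ?_
  filter_upwards [hsmall, hloc] with ζ h1 h2
  have e1 := Complex.norm_add_sq_eq (p x) (p (l ζ) - p x)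
  have e2 := Complex.norm_add_sq_eq (g x) (g (l ζ) - g x)
  have e3 := Complex.norm_add_sq_eq x.1 (ζ * v.1)
  have e4 := Complex.norm_add_sq_eq x.2 (ζ * v.2)
  have h3 : ‖g (l ζ) - g x‖ ^ 2 ≤ δ ^ 2 * ‖ζ‖ ^ 2 := by
    rw [← mul_pow]; gcongr
  have h4 : K * ‖g (l ζ) - g x‖ ^ 2 ≤ ε * V / 2 * ‖ζ‖ ^ 2 :=
    calc _ ≤ K * (δ ^ 2 * ‖ζ‖ ^ 2) := by gcongr
      _ = K * δ ^ 2 * ‖ζ‖ ^ 2 := by ring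
      _ ≤ _ := by gcongr
  have hre : (2 * conj (p x) * (p (l ζ) - p x)
      + 2 * ε * (conj x.1 * (ζ * v.1) + conj x.2 * (ζ * v.2))
      - 2 * K * conj (g x) * (g (l ζ) - g x)).re
      = 2 * (conj (p x) * (p (l ζ) - p x)).re
        + ε * (2 * (conj x.1 * (ζ * v.1)).re + 2 * (conj x.2 * (ζ * v.2)).re)
        - K * (2 * (conj (g x) * (g (l ζ) - g x)).re) := by
    simp only [Complex.add_re, Complex.sub_re, Complex.mul_re, Complex.mul_im, Complex.re_ofNat,
      Complex.im_ofNat, Complex.ofReal_re, Complex.ofReal_im, Complex.add_im]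
    ring
  rw [hre]
  have hl1 : (l ζ).1 = x.1 + ζ * v.1 := by simp [hl]
  have hl2 : (l ζ).2 = x.2 + ζ * v.2 := by simp [hl]
  rw [hl1, hl2] at h2
  rw [add_sub_cancel] at e1 e2
  rw [norm_mul] at e3 e4
  rw [e1, e2, e3, e4] at h2
  have h5 := sq_nonneg ‖p (l ζ) - p x‖
  rw [hVdef] at h4 ⊢
  nlinarith

/-- If `g 0 = 1`, then `0` lies in the hull of the part of `∂𝔻̄²` where `Re g ≥ 1/2`. -/
theorem zero_mem_polyHull_frontier_inter {g : MvPolynomial (Fin 2) ℂ} (hg : pev g 0 = 1) :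
    (0 : ℂ × ℂ) ∈ polyHull (frontier bidisk ∩ {z | 1 / 2 ≤ (pev g z).re}) := by
  intro q M hM
  by_contra! hlt
  obtain ⟨B, hB⟩ := exists_norm_pev_le q
  set ε : ℝ := (‖pev q 0‖ - M) ^ 2 / 4 with hεdef
  have hε : 0 < ε := by
    have : 0 < ‖pev q 0‖ - M := by linarith
    positivity
  set K : ℝ := 4 * (B ^ 2 + 2 * ε + 1) with hKdef
  have hK : 0 ≤ K := by positivity
  set u : ℂ × ℂ → ℝ := fun z =>
    ‖pev q z‖ ^ 2 + ε * (‖z.1‖ ^ 2 + ‖z.2‖ ^ 2) - K * ‖pev (g - 1) z‖ ^ 2 with hu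
  have hcont : Continuous u := by
    have h1 := continuous_pev q
    have h2 := continuous_pev (g - 1)
    fun_prop
  obtain ⟨x, hx, hmax⟩ := isCompact_bidisk.exists_isMaxOn ⟨0, zero_mem_bidisk⟩ hcont.continuousOn
  have hx0 : ‖pev q 0‖ ^ 2 ≤ u x := by
    have h0 : u 0 ≤ u x := hmax zero_mem_bidisk
    have h1 : u 0 = ‖pev q 0‖ ^ 2 := by simp [hu, hg]
    rwa [h1] at h0
  have hxint : x ∈ interior bidisk := by
    by_contra hxi
    have hxf : x ∈ frontier bidisk := ⟨subset_closure hx, hxi⟩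
    have hn : ‖x.1‖ ^ 2 + ‖x.2‖ ^ 2 ≤ 2 := by
      have h1 : ‖x.1‖ ^ 2 ≤ 1 := pow_le_one₀ (norm_nonneg _) hx.1
      have h2 : ‖x.2‖ ^ 2 ≤ 1 := pow_le_one₀ (norm_nonneg _) hx.2
      linarith
    have hn' : ε * (‖x.1‖ ^ 2 + ‖x.2‖ ^ 2) ≤ ε * 2 := by gcongr
    by_cases hre : 1 / 2 ≤ (pev g x).re
    · have h1 := hM x ⟨hxf, hre⟩
      have h2 : ‖pev q x‖ ^ 2 ≤ M ^ 2 := by gcongr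
      have h3 : 0 ≤ M := (norm_nonneg _).trans h1
      have h4 : 0 ≤ K * ‖pev (g - 1) x‖ ^ 2 := by positivity
      simp only [hu] at hx0
      nlinarith
    · have h1 : ‖pev q x‖ ^ 2 ≤ B ^ 2 := by have := hB x hx; gcongr
      have h2 : 1 / 2 ≤ ‖pev (g - 1) x‖ := by
        refine le_trans ?_ (Complex.abs_re_le_norm _)
        rw [pev_sub, pev_one, Complex.sub_re, Complex.one_re, le_abs]
        right; linarith
      have h3 : (1 / 2 : ℝ) ^ 2 ≤ ‖pev (g - 1) x‖ ^ 2 := by gcongr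
      have h4 : K * (1 / 2 : ℝ) ^ 2 ≤ K * ‖pev (g - 1) x‖ ^ 2 := by gcongr
      have h5 := sq_nonneg ‖pev q 0‖
      simp only [hu] at hx0
      linarith
  exact not_isLocalMax_norm_sq_add_sub (differentiable_pev q) (differentiable_pev (g - 1)) hε hK x
    (hmax.isLocalMax (mem_interior_iff_mem_nhds.1 hxint))

end MaximumPrinciple

section HalfPlanes

/-- A bounded part of the half-plane `Re t ≥ 1/2` is mapped by `t ↦ 1 - c t`, for some real `c`, into a
disc of radius less than one. -/
theorem exists_norm_one_sub_mul_sq_le (R : ℝ) :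
    ∃ c : ℝ, ∃ ρ : ℝ, 0 ≤ ρ ∧ ρ < 1 ∧
      ∀ t : ℂ, 1 / 2 ≤ t.re → ‖t‖ ≤ R → ‖1 - c * t‖ ^ 2 ≤ ρ := by
  have hc : 0 < 1 / (2 * R ^ 2 + 2) := by positivity
  set c : ℝ := 1 / (2 * R ^ 2 + 2) with hcdef
  have hc1 : c * (2 * R ^ 2 + 2) = 1 := by rw [hcdef]; field_simp
  refine ⟨c, 1 - c / 2, ?_, by linarith, fun t ht hR => ?_⟩
  · nlinarith [sq_nonneg R]
  · have h1 : ‖t‖ ^ 2 ≤ R ^ 2 := by gcongr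
    have h2 : ‖1 - (c : ℂ) * t‖ ^ 2 = 1 - 2 * c * t.re + c ^ 2 * ‖t‖ ^ 2 := by
      simp only [← Complex.normSq_eq_norm_sq, Complex.normSq_apply, Complex.sub_re,
        Complex.sub_im, Complex.mul_re, Complex.mul_im, Complex.one_re, Complex.one_im,
        Complex.ofReal_re, Complex.ofReal_im]
      ring
    have h3 : c ^ 2 * ‖t‖ ^ 2 ≤ c ^ 2 * R ^ 2 := by gcongr
    have h4 : 2 * c * (1 / 2) ≤ 2 * c * t.re := by gcongr
    nlinarith

theorem pev_ne_zero_of_mem_polyHull {Y : Set (ℂ × ℂ)} (hY : Y ⊆ bidisk)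
    {h : MvPolynomial (Fin 2) ℂ} (hre : ∀ y ∈ Y, 1 / 2 ≤ (pev h y).re) {z : ℂ × ℂ}
    (hz : z ∈ polyHull Y) : pev h z ≠ 0 := by
  intro h0
  obtain ⟨R, hR⟩ := exists_norm_pev_le h
  obtain ⟨c, ρ, hρ0, hρ1, hρ⟩ := exists_norm_one_sub_mul_sq_le R
  have key := hz ((1 - MvPolynomial.C (c : ℂ) * h) ^ 2) ρ fun y hy => by
    simpa using hρ _ (hre y hy) (hR y (hY hy))
  simp only [pev_pow, pev_sub, pev_one, pev_mul, h0, mul_zero, sub_zero, one_pow, norm_one] at key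
  linarith

/-- Given `h` with `h 0 = 1`, a power of an affine function of `h` multiplied by `P` yields `h'`
with `h' 0 = 1`, whose superlevel set `Re h' ≥ 1/2` is contained in that of `h`. -/
theorem exists_pev_superlevel_subset (h P : MvPolynomial (Fin 2) ℂ) (hh : pev h 0 = 1)
    (hP : pev P 0 ≠ 0) :
    ∃ h' : MvPolynomial (Fin 2) ℂ, pev h' 0 = 1 ∧
      (∀ z ∈ bidisk, 1 / 2 ≤ (pev h' z).re → 1 / 2 ≤ (pev h z).re) ∧
      ∀ z, pev P z = 0 → pev h' z = 0 := by
  obtain ⟨R, hR⟩ := exists_norm_pev_le (1 - h)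
  set Q := MvPolynomial.C (pev P 0)⁻¹ * P with hQ
  obtain ⟨B, hB⟩ := exists_norm_pev_le Q
  obtain ⟨c, ρ, hρ0, hρ1, hρ⟩ := exists_norm_one_sub_mul_sq_le R
  have hB0 : 0 ≤ B := (norm_nonneg _).trans (hB 0 zero_mem_bidisk)
  obtain ⟨N, hN⟩ := exists_pow_lt_of_lt_one (show (0 : ℝ) < 1 / (2 * (B + 1)) by positivity) hρ1
  refine ⟨((1 - MvPolynomial.C (c : ℂ) * (1 - h)) ^ 2) ^ N * Q, ?_, fun z hz hre => ?_,
    fun z hz => by simp [hQ, hz]⟩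
  · simp [hQ, hh, hP]
  · by_contra! hlt
    have h1 : ‖1 - (c : ℂ) * pev (1 - h) z‖ ^ 2 ≤ ρ := by
      refine hρ _ ?_ (hR z hz)
      simp only [pev_sub, pev_one, Complex.sub_re, Complex.one_re]
      linarith
    have h2 := hre.trans (Complex.re_le_norm _)
    simp only [pev_mul, pev_pow, norm_mul, norm_pow] at h2
    have h3 : pev (1 - MvPolynomial.C (c : ℂ) * (1 - h)) z = 1 - (c : ℂ) * pev (1 - h) z := by
      simp
    rw [h3] at h2
    have h4 : (‖1 - (c : ℂ) * pev (1 - h) z‖ ^ 2) ^ N * ‖pev Q z‖ ≤ ρ ^ N * B := by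
      have := hB z hz
      gcongr
    have h5 : ρ ^ N * B ≤ 1 / (2 * (B + 1)) * B := by gcongr
    have h6 : 1 / (2 * (B + 1)) * B < 1 / 2 := by
      rw [div_mul_eq_mul_div, div_lt_div_iff₀ (by positivity) (by positivity)]
      linarith
    linarith

end HalfPlanes

section Hull

theorem mem_polyHull_iff {Y : Set (ℂ × ℂ)} (hY : IsCompact Y) {z : ℂ × ℂ} :
    z ∈ polyHull Y ↔ ∀ q, ∃ y ∈ Y, ‖pev q z‖ ≤ ‖pev q y‖ := by
  refine ⟨fun hz q => ?_, fun h q M hM => ?_⟩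
  · have hne : Y.Nonempty := by
      by_contra! he
      have := hz 0 (-1) (by simp [he])
      linarith [norm_nonneg (pev 0 z)]
    obtain ⟨y, hy, hmax⟩ := hY.exists_isMaxOn hne (continuous_pev q).norm.continuousOn
    exact ⟨y, hy, hz q _ fun w hw => hmax hw⟩
  · obtain ⟨y, hy, hle⟩ := h q
    exact hle.trans (hM y hy)

/-- Countably many algebraic curves missing the origin can be avoided by the hull of a compact
subset of `∂𝔻̄²` whose hull contains the origin. -/
theorem exists_isCompact_zero_mem_polyHull_forall_pev_ne_zero
    (P : ℕ → MvPolynomial (Fin 2) ℂ) (hP : ∀ n, pev (P n) 0 ≠ 0) :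
    ∃ Y : Set (ℂ × ℂ), IsCompact Y ∧ Y ⊆ frontier bidisk ∧ (0 : ℂ × ℂ) ∈ polyHull Y ∧
      ∀ n, ∀ z ∈ polyHull Y, pev (P n) z ≠ 0 := by
  choose f hf1 hf2 hf3 using exists_pev_superlevel_subset
  let H : ℕ → {h : MvPolynomial (Fin 2) ℂ // pev h 0 = 1} := fun n =>
    Nat.rec ⟨1, pev_one 0⟩ (fun n h => ⟨f h.1 (P n) h.2 (hP n), hf1 _ _ _ _⟩) n
  let Z : ℕ → Set (ℂ × ℂ) := fun n => frontier bidisk ∩ {z | 1 / 2 ≤ (pev (H n).1 z).re}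
  have hZclosed : ∀ n, IsClosed {z | 1 / 2 ≤ (pev (H n).1 z).re} := fun n =>
    isClosed_le continuous_const (Complex.continuous_re.comp (continuous_pev _))
  have hZ : ∀ n, IsCompact (Z n) := fun n => isCompact_frontier_bidisk.inter_right (hZclosed n)
  have hanti : ∀ n, Z (n + 1) ⊆ Z n := fun n z hz =>
    ⟨hz.1, hf2 _ _ (H n).2 (hP n) z (frontier_bidisk_subset hz.1) hz.2⟩
  have hY : IsCompact (⋂ n, Z n) :=
    (hZ 0).of_isClosed_subset (isClosed_iInter fun n => (hZ n).isClosed) (iInter_subset Z 0)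
  have hYsub : (⋂ n, Z n) ⊆ frontier bidisk := fun z hz => (mem_iInter.1 hz 0).1
  refine ⟨⋂ n, Z n, hY, hYsub, ?_, fun n z hz h0 => ?_⟩
  · rw [mem_polyHull_iff hY]
    intro q
    have hq : IsClosed {y | ‖pev q 0‖ ≤ ‖pev q y‖} :=
      isClosed_le continuous_const (continuous_pev q).norm
    obtain ⟨y, hy⟩ := IsCompact.nonempty_iInter_of_sequence_nonempty_isCompact_isClosed
      (fun n => Z n ∩ {y | ‖pev q 0‖ ≤ ‖pev q y‖})
      (fun n => inter_subset_inter_left _ (hanti n))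
      (fun n => (mem_polyHull_iff (hZ n)).1 (zero_mem_polyHull_frontier_inter (H n).2) q)
      ((hZ 0).inter_right hq) (fun n => ((hZ n).inter_right hq).isClosed)
    rw [mem_iInter] at hy
    exact ⟨y, mem_iInter.2 fun n => (hy n).1, (hy 0).2⟩
  · exact pev_ne_zero_of_mem_polyHull (hYsub.trans frontier_bidisk_subset)
      (h := (H (n + 1)).1) (fun y hy => (mem_iInter.1 hy (n + 1)).2) hz
      (hf3 _ _ (H n).2 (hP n) z h0)

end Hull

section Spectrum

/-- The restriction of a polynomial to a compact set `Y`, as an element of `P(Y)`. -/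
noncomputable def polyRestrict {Y : Set (ℂ × ℂ)} (hY : IsCompact Y)
    (q : MvPolynomial (Fin 2) ℂ) : PY Y :=
  haveI := isCompact_iff_compactSpace.1 hY
  ⟨mkOfCompact ⟨fun y : Y => pev q y, (continuous_pev q).comp continuous_subtype_val⟩,
    (polySub Y).le_topologicalClosure ⟨q, fun _ => rfl⟩⟩

variable {Y : Set (ℂ × ℂ)} (hY : IsCompact Y)

@[simp] theorem polyRestrict_apply (q : MvPolynomial (Fin 2) ℂ) (y : Y) :
    (polyRestrict hY q : Y →ᵇ ℂ) y = pev q y := rfl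

/-- `polyRestrict` as an algebra homomorphism. -/
noncomputable def polyRestrictHom : MvPolynomial (Fin 2) ℂ →ₐ[ℂ] PY Y where
  toFun := polyRestrict hY
  map_one' := by ext y; simp
  map_mul' p q := by ext y; simp
  map_zero' := by ext y; simp [pev]
  map_add' p q := by ext y; simp
  commutes' c := by ext y; simp [MvPolynomial.algebraMap_eq]

/-- The spectrum in `P(Y)` of a polynomial is contained in its image on the hull of `Y`. -/
theorem spectrum_polyRestrict_subset (hne : Y.Nonempty) (q : MvPolynomial (Fin 2) ℂ) :
    spectrum ℂ (polyRestrict hY q) ⊆ pev q '' polyHull Y := by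
  have : Nonempty Y := hne.to_subtype
  have : CompleteSpace (PY Y) :=
    (polySub Y).isClosed_topologicalClosure.completeSpace_coe
  have : NormOneClass (PY Y) := ⟨norm_one (α := Y →ᵇ ℂ)⟩
  intro c hc
  obtain ⟨φ, hφ⟩ := WeakDual.CharacterSpace.mem_spectrum_iff_exists.1 hc
  let ψ : PY Y →ₐ[ℂ] ℂ := WeakDual.CharacterSpace.toAlgHom φ
  let x : ℂ × ℂ := (ψ (polyRestrict hY (.X 0)), ψ (polyRestrict hY (.X 1)))
  have hx : ∀ r, ψ (polyRestrict hY r) = pev r x := by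
    intro r
    have : ψ.comp (polyRestrictHom hY) = MvPolynomial.aeval ![x.1, x.2] := by
      apply MvPolynomial.algHom_ext
      intro i
      fin_cases i <;> simp [x, polyRestrictHom]
    have h := DFunLike.congr_fun this r
    rw [MvPolynomial.aeval_eq_eval] at h
    exact h
  refine ⟨x, fun r M hM => ?_, (hx q).symm.trans hφ⟩
  rw [← hx r]
  refine (AlgHom.norm_apply_le_self ψ _).trans ?_
  exact (norm_le_of_nonempty (f := (polyRestrict hY r : Y →ᵇ ℂ))).2 fun y => hM y y.2

end Spectrum

/-- There is a sequence of polynomials that is uniformly dense on the bidisk among all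
polynomials. -/
theorem exists_seq_pev_dense : ∃ q : ℕ → MvPolynomial (Fin 2) ℂ,
    ∀ (p : MvPolynomial (Fin 2) ℂ) (ε : ℝ), 0 < ε →
      ∃ n, ∀ z ∈ bidisk, ‖pev p z - pev (q n) z‖ < ε := by
  have := isCompact_iff_compactSpace.1 isCompact_bidisk
  let F : MvPolynomial (Fin 2) ℂ → C(bidisk, ℂ) := fun p =>
    ⟨fun z => pev p z, (continuous_pev p).comp continuous_subtype_val⟩
  have : Nonempty (range F) := ⟨⟨F 0, mem_range_self 0⟩⟩
  choose q hq using fun n => (TopologicalSpace.denseSeq (range F) n).2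
  refine ⟨q, fun p ε hε => ?_⟩
  obtain ⟨n, hn⟩ := (TopologicalSpace.denseRange_denseSeq (range F)).exists_dist_lt
    ⟨F p, mem_range_self p⟩ hε
  refine ⟨n, fun z hz => ?_⟩
  rw [Subtype.dist_eq, ← hq n] at hn
  simpa [F, dist_eq_norm] using
    (ContinuousMap.dist_apply_le_dist (f := F p) (g := F (q n)) ⟨z, hz⟩).trans_lt hn

/-- There exists a nonempty compact set `Y ⊆ ∂𝔻̄²` with `(0,0)` in its polynomial hull,
such that the set of elements of the Banach algebra `P(Y)` whose spectrum has empty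
interior in `ℂ` is dense in `P(Y)`. -/
theorem stmt1 :
    ∃ Y : Set (ℂ × ℂ), Y.Nonempty ∧ IsCompact Y ∧ Y ⊆ frontier bidisk ∧
      ((0 : ℂ), (0 : ℂ)) ∈ polyHull Y ∧
      Dense {f : PY Y | interior (spectrum ℂ f) = ∅} := by
  classical
  obtain ⟨q, hq⟩ := exists_seq_pev_dense
  let c : ℕ → ℂ := TopologicalSpace.denseSeq ℂ
  let P : ℕ → MvPolynomial (Fin 2) ℂ := fun n =>
    if pev (q n.unpair.1) 0 = c n.unpair.2 then 1
    else q n.unpair.1 - MvPolynomial.C (c n.unpair.2)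
  have hP : ∀ n, pev (P n) 0 ≠ 0 := by
    intro n
    by_cases h : pev (q n.unpair.1) 0 = c n.unpair.2
    · simp [P, h]
    · simp [P, h, sub_eq_zero]
  obtain ⟨Y, hY, hYsub, h0, hne⟩ :=
    exists_isCompact_zero_mem_polyHull_forall_pev_ne_zero P hP
  have hYne : Y.Nonempty := by
    obtain ⟨y, hy, -⟩ := (mem_polyHull_iff hY).1 h0 0
    exact ⟨y, hy⟩
  have : Nonempty Y := hYne.to_subtype
  refine ⟨Y, hYne, hY, hYsub, h0, ?_⟩
  have hspec : ∀ i, interior (spectrum ℂ (polyRestrict hY (q i))) = ∅ := by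
    intro i
    rw [interior_eq_empty_iff_dense_compl]
    refine ((TopologicalSpace.denseRange_denseSeq ℂ).sdiff_singleton (pev (q i) 0)).mono ?_
    rintro _ ⟨⟨j, rfl⟩, hj⟩ hmem
    obtain ⟨x, hx, hxj⟩ := spectrum_polyRestrict_subset hY hYne (q i) hmem
    refine hne (Nat.pair i j) x hx ?_
    have hj' : ¬ pev (q i) 0 = c j := fun h => hj h.symm
    simp [P, hj', hxj, c]
  rw [Metric.dense_iff]
  intro f ε hε
  obtain ⟨g, ⟨p, hp⟩, hg⟩ := Metric.mem_closure_iff.1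
    (show (f : Y →ᵇ ℂ) ∈ closure (polySub Y : Set (Y →ᵇ ℂ)) from f.2) (ε / 2) (half_pos hε)
  obtain ⟨n, hn⟩ := hq p (ε / 2) (half_pos hε)
  refine ⟨polyRestrict hY (q n), ?_, hspec n⟩
  rw [Metric.mem_ball, dist_comm, Subtype.dist_eq]
  have h2 : dist g (polyRestrict hY (q n) : Y →ᵇ ℂ) ≤ ε / 2 := by
    refine (dist_le (half_pos hε).le).2 fun y => ?_
    rw [hp y, polyRestrict_apply, dist_eq_norm]
    exact (hn y (frontier_bidisk_subset (hYsub y.2))).le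
  linarith [dist_triangle (f : Y →ᵇ ℂ) g (polyRestrict hY (q n) : Y →ᵇ ℂ)]
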